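/- Let q be an acyclic Boolean conjunctive query and τ a join tree for q such that every cycle of the attack graph of τ is terminal and every atom of q belongs to some cycle of the attack graph of τ. Then: (1) if a variable x occurs in an atom of one cycle of the attack graph and also in an atom of a different cycle of the attack graph, then x ∈ key(F) for every atom F belonging to either of these two cycles; (2) if F ↝ G is a weak attack in the attack graph of τ, then key(G) ⊆ vars(F). -/

import Mathlib

attribute [local instance] Classical.propDecidable

noncomputable section

/-- A term is either a variable (`Sum.inl v`) or a constant (`Sum.inr c`),
variables and constants both being coded by natural numbers
(the two copies of `ℕ` are disjoint). -/
abbrev Trm := ℕ ⊕ ℕ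

/-- A database schema assigns to every relation name (a natural number) an
arity `n` and a primary-key length `k` with `n ≥ k ≥ 1`; the primary key
consists of the first `k` positions. -/
structure Schema where
  arity : ℕ → ℕ
  keyLen : ℕ → ℕ
  keyLen_le_arity : ∀ R, keyLen R ≤ arity R
  one_le_keyLen : ∀ R, 1 ≤ keyLen R

/-- An atom: a relation name together with a list of arguments. -/
structure Atom where
  rel : ℕ
  args : List Trm
deriving DecidableEq

/-- Variables occurring in a list of terms. -/
def varsL (l : List Trm) : Finset ℕ := (l.filterMap Sum.getLeft?).toFinset

/-- Constants occurring in a list of terms. -/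
def constsL (l : List Trm) : Finset ℕ := (l.filterMap Sum.getRight?).toFinset

/-- All variables of an atom. -/
def varsA (A : Atom) : Finset ℕ := varsL A.args

/-- Key variables of an atom: variables in the primary-key positions. -/
def keyVars (S : Schema) (A : Atom) : Finset ℕ := varsL (A.args.take (S.keyLen A.rel))

/-- Constants of an atom. -/
def constsA (A : Atom) : Finset ℕ := constsL A.args

/-- Well-formed atom: number of arguments equals the arity of its relation name. -/
def wfAtom (S : Schema) (A : Atom) : Prop := A.args.length = S.arity A.rel

/-- A fact is an atom without variables. -/
def isFact (A : Atom) : Prop := ∀ t ∈ A.args, ∃ c : ℕ, t = Sum.inr c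

/-- Two (facts) are key-equal: same relation name, and same primary-key positions. -/
def keyEqual (S : Schema) (A B : Atom) : Prop :=
  A.rel = B.rel ∧ A.args.take (S.keyLen A.rel) = B.args.take (S.keyLen B.rel)

/-- The block of `A` in `db`: all facts of `db` key-equal to `A`. -/
def block (S : Schema) (A : Atom) (db : Finset Atom) : Finset Atom :=
  db.filter (fun B => keyEqual S A B)

/-- An uncertain database: a finite set of well-formed facts. -/
def IsDb (S : Schema) (db : Finset Atom) : Prop := ∀ A ∈ db, isFact A ∧ wfAtom S A

/-- A set of facts is consistent if it contains no two distinct key-equal facts. -/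
def Consistent (S : Schema) (db : Finset Atom) : Prop :=
  ∀ A ∈ db, ∀ B ∈ db, keyEqual S A B → A = B

/-- A repair of `db`: a maximal consistent subset of `db`. -/
def IsRepair (S : Schema) (db r : Finset Atom) : Prop :=
  r ⊆ db ∧ Consistent S r ∧
    ∀ r' : Finset Atom, r ⊆ r' → r' ⊆ db → Consistent S r' → r' = r

/-- Applying a valuation (a total map from variables to constants) to a term. -/
def appT (θ : ℕ → ℕ) : Trm → Trm
  | Sum.inl v => Sum.inr (θ v)
  | Sum.inr c => Sum.inr c

/-- Applying a valuation to an atom. -/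
def appA (θ : ℕ → ℕ) (A : Atom) : Atom := ⟨A.rel, A.args.map (appT θ)⟩

/-- Applying a valuation to a query. -/
def appQ (θ : ℕ → ℕ) (q : Finset Atom) : Finset Atom := q.image (appA θ)

/-- `db ⊨ q`: some valuation sends every atom of `q` into `db`. -/
def Sat (db q : Finset Atom) : Prop := ∃ θ : ℕ → ℕ, appQ θ q ⊆ db

/-- `db ∈ CERTAINTY(q)`: every repair of `db` satisfies `q`. -/
def Certainty (S : Schema) (q db : Finset Atom) : Prop :=
  ∀ r : Finset Atom, IsRepair S db r → Sat r q

/-- Variables of a query. -/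
def varsQ (q : Finset Atom) : Finset ℕ := q.biUnion varsA

/-- Constants of a query. -/
def constsQ (q : Finset Atom) : Finset ℕ := q.biUnion constsA

/-- `q` has no self-join: no two distinct atoms share a relation name. -/
def NoSelfJoin (q : Finset Atom) : Prop := ∀ F ∈ q, ∀ G ∈ q, F.rel = G.rel → F = G

/-- `db` is purified relative to `q`. -/
def Purified (q db : Finset Atom) : Prop :=
  ∀ A ∈ db, ∃ θ : ℕ → ℕ, A ∈ appQ θ q ∧ appQ θ q ⊆ db

/-- Active domain of a database: all constants occurring in its facts. -/
def adom (db : Finset Atom) : Finset ℕ := db.biUnion constsA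

/-- Membership in the attribute closure of `X` under a set `FDs` of
functional dependencies (standard implication of functional dependencies). -/
inductive InCl (FDs : Set (Finset ℕ × Finset ℕ)) (X : Finset ℕ) : ℕ → Prop
  | base {x : ℕ} : x ∈ X → InCl FDs X x
  | step {Z W : Finset ℕ} {w : ℕ} : (Z, W) ∈ FDs → (∀ z ∈ Z, InCl FDs X z) →
      w ∈ W → InCl FDs X w

/-- `FDs ⊨ X → Y`. -/
def FDImp (FDs : Set (Finset ℕ × Finset ℕ)) (X Y : Finset ℕ) : Prop :=
  ∀ y ∈ Y, InCl FDs X y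

/-- `FD(q) = { key(F) → vars(F) : F ∈ q }`. -/
def FDq (S : Schema) (q : Finset Atom) : Set (Finset ℕ × Finset ℕ) :=
  {p | ∃ F ∈ q, p = (keyVars S F, varsA F)}

/-- `F^{+,q} = {x ∈ vars(q) : FD(q \ {F}) ⊨ key(F) → x}`. -/
def plusCl (S : Schema) (q : Finset Atom) (F : Atom) : Set ℕ :=
  {x | x ∈ varsQ q ∧ InCl (FDq S (q.erase F)) (keyVars S F) x}

/-- `F^{⊕,q} = {x ∈ vars(q) : FD(q) ⊨ key(F) → x}`. -/
def oplusCl (S : Schema) (q : Finset Atom) (F : Atom) : Set ℕ :=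
  {x | x ∈ varsQ q ∧ InCl (FDq S q) (keyVars S F) x}

/-- A (simple) path in an undirected graph given by edge relation `E`. -/
def IsPath (E : Atom → Atom → Prop) (p : List Atom) : Prop :=
  p ≠ [] ∧ p.Nodup ∧ List.Chain' E p

/-- `E` is (the edge relation of) a join tree for `q`: a tree (unique simple
paths between any two vertices) on the atoms of `q` satisfying the
Connectedness Condition. -/
def IsJoinTree (q : Finset Atom) (E : Atom → Atom → Prop) : Prop :=
  (∀ a b, E a b → E b a) ∧
  (∀ a b, E a b → a ∈ q ∧ b ∈ q ∧ a ≠ b) ∧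
  (∀ a ∈ q, ∀ b ∈ q, ∃! p : List Atom,
      IsPath E p ∧ p.head? = some a ∧ p.getLast? = some b) ∧
  (∀ x : ℕ, ∀ F ∈ q, ∀ G ∈ q, x ∈ varsA F → x ∈ varsA G →
      ∀ p : List Atom, IsPath E p → p.head? = some F → p.getLast? = some G →
        ∀ H ∈ p, x ∈ varsA H)

/-- The consecutive pairs (edges) of a path. -/
def edgePairs (p : List Atom) : List (Atom × Atom) := p.zip p.tail

/-- `F ↝ G` in the attack graph of the join tree `E` of `q`: `F ≠ G` are atoms
of `q`, and no label `vars(H) ∩ vars(H')` of an edge on the (unique) path from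
`F` to `G` is contained in `F^{+,q}`. -/
def Attacks (S : Schema) (q : Finset Atom) (E : Atom → Atom → Prop) (F G : Atom) : Prop :=
  F ∈ q ∧ G ∈ q ∧ F ≠ G ∧
  ∀ p : List Atom, IsPath E p → p.head? = some F → p.getLast? = some G →
    ∀ e ∈ edgePairs p, ¬ ((↑(varsA e.1 ∩ varsA e.2) : Set ℕ) ⊆ plusCl S q F)

/-- The attack `F ↝ G` is weak: `key(G) ⊆ F^{⊕,q}`. -/
def Weak (S : Schema) (q : Finset Atom) (F G : Atom) : Prop :=
  (↑(keyVars S G) : Set ℕ) ⊆ oplusCl S q F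

/-- Consecutive pairs of a cyclic sequence, including the wrap-around pair. -/
def cyclePairs (L : List Atom) : List (Atom × Atom) := L.zip (L.rotate 1)

/-- `L` is an (elementary directed) cycle in the directed graph `att`. -/
def IsCycle (att : Atom → Atom → Prop) (L : List Atom) : Prop :=
  2 ≤ L.length ∧ L.Nodup ∧ ∀ e ∈ cyclePairs L, att e.1 e.2

/-- A cycle is terminal: no edge leads from a vertex in the cycle to a vertex
outside the cycle. -/
def TerminalCycle (att : Atom → Atom → Prop) (L : List Atom) : Prop :=
  ∀ a ∈ L, ∀ b, att a b → b ∈ L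

/-- A strong cycle in the attack graph: a cycle at least one attack of which is strong. -/
def StrongCycle (S : Schema) (q : Finset Atom) (E : Atom → Atom → Prop)
    (L : List Atom) : Prop :=
  IsCycle (Attacks S q E) L ∧ ∃ e ∈ cyclePairs L, ¬ Weak S q e.1 e.2

/-- Substituting constant `c` for variable `z` in a term. -/
def substT (z c : ℕ) : Trm → Trm
  | Sum.inl v => if v = z then Sum.inr c else Sum.inl v
  | Sum.inr d => Sum.inr d

/-- `F[z→c]`. -/
def substA (z c : ℕ) (A : Atom) : Atom := ⟨A.rel, A.args.map (substT z c)⟩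

/-- `q[z→c]`. -/
def substQ (z c : ℕ) (q : Finset Atom) : Finset Atom := q.image (substA z c)

/-- Simultaneous substitution of the constants `bs` for the (distinct)
variables `xs` (componentwise) in a term. -/
def substLT (xs bs : List ℕ) : Trm → Trm
  | Sum.inl v => if v ∈ xs then Sum.inr (bs.getD (xs.idxOf v) 0) else Sum.inl v
  | Sum.inr d => Sum.inr d

/-- `F[x⃗→b⃗]`. -/
def substLA (xs bs : List ℕ) (A : Atom) : Atom := ⟨A.rel, A.args.map (substLT xs bs)⟩

/-- `q[x⃗→b⃗]`. -/
def substLQ (xs bs : List ℕ) (q : Finset Atom) : Finset Atom := q.image (substLA xs bs)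

/-- First-order formulas over the relational vocabulary (relation names and
constants coded by naturals, variables coded by naturals). -/
inductive Fml where
  | atom (R : ℕ) (args : List Trm)
  | eq (s t : Trm)
  | tru
  | not (φ : Fml)
  | and (φ ψ : Fml)
  | or (φ ψ : Fml)
  | ex (v : ℕ) (φ : Fml)
  | all (v : ℕ) (φ : Fml)

/-- Value of a term under an assignment of constants to variables. -/
def evalT (σ : ℕ → ℕ) : Trm → ℕ
  | Sum.inl v => σ v
  | Sum.inr c => c

/-- Satisfaction of a first-order formula in the finite structure whose
relations are given by the facts of `db`, with quantifiers ranging over `dom`. -/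
def Holds (db : Finset Atom) (dom : Finset ℕ) : Fml → (ℕ → ℕ) → Prop
  | .atom R args, σ => (⟨R, args.map fun t => Sum.inr (evalT σ t)⟩ : Atom) ∈ db
  | .eq s t, σ => evalT σ s = evalT σ t
  | .tru, _ => True
  | .not φ, σ => ¬ Holds db dom φ σ
  | .and φ ψ, σ => Holds db dom φ σ ∧ Holds db dom ψ σ
  | .or φ ψ, σ => Holds db dom φ σ ∨ Holds db dom ψ σ
  | .ex v φ, σ => ∃ a ∈ dom, Holds db dom φ (Function.update σ v a)
  | .all v φ, σ => ∀ a ∈ dom, Holds db dom φ (Function.update σ v a)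

/-- Free variables of a formula. -/
def Fml.free : Fml → Finset ℕ
  | .atom _ args => varsL args
  | .eq s t => varsL [s, t]
  | .tru => ∅
  | .not φ => φ.free
  | .and φ ψ => φ.free ∪ ψ.free
  | .or φ ψ => φ.free ∪ ψ.free
  | .ex v φ => φ.free.erase v
  | .all v φ => φ.free.erase v

/-- Relation names occurring in a formula. -/
def Fml.rels : Fml → Finset ℕ
  | .atom R _ => {R}
  | .eq _ _ => ∅
  | .tru => ∅
  | .not φ => φ.rels
  | .and φ ψ => φ.rels ∪ ψ.rels
  | .or φ ψ => φ.rels ∪ ψ.rels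
  | .ex _ φ => φ.rels
  | .all _ φ => φ.rels

/-- Constants occurring in a formula. -/
def Fml.consts : Fml → Finset ℕ
  | .atom _ args => constsL args
  | .eq s t => constsL [s, t]
  | .tru => ∅
  | .not φ => φ.consts
  | .and φ ψ => φ.consts ∪ ψ.consts
  | .or φ ψ => φ.consts ∪ ψ.consts
  | .ex _ φ => φ.consts
  | .all _ φ => φ.consts

/-- Well-formed formula: every atom has as many arguments as the arity of its
relation name. -/
def FmlWf (S : Schema) : Fml → Prop
  | .atom R args => args.length = S.arity R
  | .eq _ _ => True
  | .tru => True
  | .not φ => FmlWf S φ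
  | .and φ ψ => FmlWf S φ ∧ FmlWf S ψ
  | .or φ ψ => FmlWf S φ ∧ FmlWf S ψ
  | .ex _ φ => FmlWf S φ
  | .all _ φ => FmlWf S φ

/-- The safety predicate of Dalvi, Ré and Suciu (rules SE1–SE4). -/
inductive Safe (S : Schema) : Finset Atom → Prop
  | se1 (A : Atom) : isFact A → Safe S {A}
  | se2 (q₁ q₂ : Finset Atom) : q₁.Nonempty → q₂.Nonempty →
      Disjoint (varsQ q₁) (varsQ q₂) → Safe S q₁ → Safe S q₂ → Safe S (q₁ ∪ q₂)
  | se3 (q : Finset Atom) (x a : ℕ) : (∀ F ∈ q, x ∈ keyVars S F) →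
      Safe S (substQ x a q) → Safe S q
  | se4 (q : Finset Atom) (F : Atom) (x a : ℕ) : F ∈ q → keyVars S F = ∅ →
      varsA F ≠ ∅ → x ∈ varsA F → Safe S (substQ x a q) → Safe S q

/-- The atom `R_i(x_i ; x_{i+1})` (with `x_{k+1} = x_1`) of the query `acq_k`;
variable `x_i` is coded by `i`, relation name `R_i` by `i`. -/
def Ratom (k i : ℕ) : Atom := ⟨i, [Sum.inl i, Sum.inl (i % k + 1)]⟩

/-- The all-key atom `S_k(x_1,…,x_k)` of the query `acq_k`;
relation name `S_k` is coded by `0`. -/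
def Satom (k : ℕ) : Atom := ⟨0, (List.range k).map (fun j => Sum.inl (j + 1))⟩

/-- The query `acq_k = {R_1(x_1;x_2), …, R_k(x_k;x_1), S_k(x_1,…,x_k)}`. -/
def acq (k : ℕ) : Finset Atom := ((Finset.Icc 1 k).image (Ratom k)) ∪ {Satom k}

/-- Sum of `Pr` over the possible (= consistent) worlds of `db` satisfying `P`. -/
def prOf (S : Schema) (db : Finset Atom) (Pr : Finset Atom → ℚ)
    (P : Finset Atom → Prop) : ℚ :=
  ∑ w ∈ db.powerset.filter (fun w => Consistent S w ∧ P w), Pr w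

end

open Relation in
/-- A list whose consecutive pairs are related gives reachability between its ends. -/
theorem aux_path_rtg {R : Atom → Atom → Prop} : ∀ (p : List Atom) (a b : Atom),
    p.head? = some a → p.getLast? = some b → (∀ e ∈ edgePairs p, R e.1 e.2) →
    ReflTransGen R a b := by
  intro p
  induction p with
  | nil => intro a b h; simp at h
  | cons c t ih =>
    intro a b ha hb he
    simp only [List.head?_cons, Option.some.injEq] at ha
    subst ha
    cases t with
    | nil =>
      simp only [List.getLast?_singleton, Option.some.injEq] at hb
      subst hb
      exact ReflTransGen.refl
    | cons d s =>
      have h1 : R c d := he (c, d) (by simp [edgePairs])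
      refine ReflTransGen.head h1 (ih d b rfl ?_ ?_)
      · simpa [List.getLast?_cons_cons] using hb
      · intro e hm
        apply he
        simp only [edgePairs, List.tail_cons, List.zip_cons_cons, List.mem_cons]
        right
        simpa [edgePairs] using hm

theorem aux_chain_edge {R : Atom → Atom → Prop} : ∀ (p : List Atom), List.IsChain R p →
    ∀ e ∈ edgePairs p, R e.1 e.2 := by
  intro p
  induction p with
  | nil => intro _ e he; simp [edgePairs] at he
  | cons c t ih =>
    intro h e he
    cases t with
    | nil => simp [edgePairs] at he
    | cons d s =>
      rw [List.isChain_cons_cons] at h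
      simp only [edgePairs, List.tail_cons, List.zip_cons_cons, List.mem_cons] at he
      rcases he with rfl | he
      · exact h.1
      · exact ih h.2 e (by simpa [edgePairs] using he)

theorem aux_edge_mem {p : List Atom} {e : Atom × Atom} (he : e ∈ edgePairs p) :
    e.1 ∈ p ∧ e.2 ∈ p := by
  obtain ⟨a, b⟩ := e
  have := List.of_mem_zip he
  exact ⟨this.1, List.mem_of_mem_tail this.2⟩

open Relation in
/-- Reachability gives a simple path. -/
theorem aux_rtg_path {R : Atom → Atom → Prop} {a b : Atom} (h : ReflTransGen R a b) :
    ∃ p : List Atom, p ≠ [] ∧ p.Nodup ∧ List.IsChain R p ∧ p.head? = some a ∧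
      p.getLast? = some b := by
  induction h using ReflTransGen.head_induction_on with
  | refl => exact ⟨[b], by simp⟩
  | @head a c hac _ ih =>
    obtain ⟨p, hne, hnd, hch, hh, hl⟩ := ih
    by_cases hmem : a ∈ p
    · obtain ⟨s, t, rfl⟩ := List.append_of_mem hmem
      refine ⟨a :: t, by simp, hnd.of_append_right, (List.isChain_append.1 hch).2.1, rfl, ?_⟩
      simpa [List.getLast?_append] using hl
    · refine ⟨a :: p, by simp, List.nodup_cons.2 ⟨hmem, hnd⟩, ?_, rfl, ?_⟩
      · rw [List.isChain_cons]
        refine ⟨?_, hch⟩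
        intro y hy
        rw [hh] at hy
        cases hy
        exact hac
      · cases p with
        | nil => exact absurd rfl hne
        | cons d s => simpa [List.getLast?_cons_cons] using hl

/-- Edges of the join tree whose label is not contained in `F^{+,q}`. -/
def auxR (S : Schema) (q : Finset Atom) (E : Atom → Atom → Prop) (F a b : Atom) : Prop :=
  E a b ∧ ¬ ((↑(varsA a ∩ varsA b) : Set ℕ) ⊆ plusCl S q F)

open Relation in
theorem aux_att_iff {S : Schema} {q : Finset Atom} {E : Atom → Atom → Prop}
    (hjt : IsJoinTree q E) {F G : Atom} :
    Attacks S q E F G ↔ F ∈ q ∧ G ∈ q ∧ F ≠ G ∧ ReflTransGen (auxR S q E F) F G := by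
  constructor
  · rintro ⟨hF, hG, hne, h⟩
    refine ⟨hF, hG, hne, ?_⟩
    obtain ⟨p, ⟨hp, hh, hl⟩, -⟩ := hjt.2.2.1 F hF G hG
    exact aux_path_rtg p F G hh hl
      (fun e he => ⟨aux_chain_edge p hp.2.2 e he, h p hp hh hl e he⟩)
  · rintro ⟨hF, hG, hne, h⟩
    refine ⟨hF, hG, hne, ?_⟩
    obtain ⟨p, hp1, hp2, hp3, hp4, hp5⟩ := aux_rtg_path h
    intro p' hp' hh hl e he
    have heq : p' = p := (hjt.2.2.1 F hF G hG).unique ⟨hp', hh, hl⟩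
      ⟨⟨hp1, hp2, hp3.imp (fun _ _ h => h.1)⟩, hp4, hp5⟩
    subst heq
    exact (aux_chain_edge p' hp3 e he).2

theorem aux_key_sub (S : Schema) (F : Atom) {x : ℕ} (hx : x ∈ keyVars S F) : x ∈ varsA F := by
  unfold keyVars varsL at hx
  unfold varsA varsL
  rw [List.mem_toFinset] at *
  exact (List.Sublist.filterMap _ (List.take_sublist _ _)).subset hx

theorem aux_varsQ {q : Finset Atom} {F : Atom} (hF : F ∈ q) {x : ℕ} (hx : x ∈ varsA F) :
    x ∈ varsQ q := Finset.mem_biUnion.2 ⟨F, hF, hx⟩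

open Relation in
/-- If `A` is in the component of `G`, and `x ∉ G^+` is shared by `A` and `B`,
then `B` is in the component too. -/
theorem aux_share {S : Schema} {q : Finset Atom} {E : Atom → Atom → Prop}
    (hjt : IsJoinTree q E) {G A B : Atom} (hA : A ∈ q) (hB : B ∈ q) {x : ℕ}
    (hxA : x ∈ varsA A) (hxB : x ∈ varsA B)
    (hGA : ReflTransGen (auxR S q E G) G A) (hx : x ∉ plusCl S q G) :
    ReflTransGen (auxR S q E G) G B := by
  refine hGA.trans ?_
  obtain ⟨p, ⟨hp, hh, hl⟩, -⟩ := hjt.2.2.1 A hA B hB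
  refine aux_path_rtg p A B hh hl (fun e he => ⟨aux_chain_edge p hp.2.2 e he, ?_⟩)
  intro hsub
  have hm := aux_edge_mem he
  have hv := hjt.2.2.2 x A hA B hB hxA hxB p hp hh hl
  apply hx
  apply hsub
  simp only [Finset.coe_inter, Set.mem_inter_iff, Finset.mem_coe]
  exact ⟨hv _ hm.1, hv _ hm.2⟩

/-- `F^+` is closed under the other atoms. -/
theorem aux_plus_closed {S : Schema} {q : Finset Atom} {F K : Atom} (hK : K ∈ q) (hne : K ≠ F)
    (hkey : ∀ z ∈ keyVars S K, z ∈ plusCl S q F) {v : ℕ} (hv : v ∈ varsA K) :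
    v ∈ plusCl S q F :=
  ⟨aux_varsQ hK hv, InCl.step (Z := keyVars S K) (W := varsA K)
    ⟨K, Finset.mem_erase.2 ⟨hne, hK⟩, rfl⟩ (fun z hz => (hkey z hz).2) hv⟩

open Relation in
/-- If `F` attacks `G` then `key(G)` is not contained in `F^+`. -/
theorem aux_att_key {S : Schema} {q : Finset Atom} {E : Atom → Atom → Prop}
    (hjt : IsJoinTree q E) {F G : Atom} (h : Attacks S q E F G) :
    ¬ ∀ z ∈ keyVars S G, z ∈ plusCl S q F := by
  intro hk
  obtain ⟨_, hG, hne, h⟩ := (aux_att_iff hjt).1 h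
  rcases ReflTransGen.cases_tail h with h | ⟨c, _, hc⟩
  · exact hne h.symm
  · apply hc.2
    intro v hv
    simp only [Finset.coe_inter, Set.mem_inter_iff, Finset.mem_coe] at hv
    exact aux_plus_closed hG (Ne.symm hne) hk hv.2

open Relation in
/-- The key transitivity-like property of attack graphs. -/
theorem aux_trans {S : Schema} {q : Finset Atom} {E : Atom → Atom → Prop}
    (hjt : IsJoinTree q E) {F G H : Atom} (h1 : Attacks S q E F G) (h2 : Attacks S q E G H)
    (hne : F ≠ H) : Attacks S q E F H ∨ Attacks S q E G F := by
  by_cases hGF : Attacks S q E G F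
  · exact Or.inr hGF
  left
  have hk := aux_att_key hjt h1
  obtain ⟨hF, hG, hFG, h1⟩ := (aux_att_iff hjt).1 h1
  obtain ⟨-, hH, hGH, h2⟩ := (aux_att_iff hjt).1 h2
  have hF' : ¬ ReflTransGen (auxR S q E G) G F :=
    fun h => hGF ((aux_att_iff hjt).2 ⟨hG, hF, hFG.symm, h⟩)
  have key : ∀ v, InCl (FDq S (q.erase F)) (keyVars S F) v →
      ∀ A ∈ q, ReflTransGen (auxR S q E G) G A → v ∈ varsA A → v ∈ plusCl S q G := by
    intro v hv
    induction hv with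
    | @base v hv =>
      intro A hA hGA hvA
      by_contra hcon
      exact hF' (aux_share hjt hA hF hvA (aux_key_sub S F hv) hGA hcon)
    | @step Z W w hZW hZ hw ih =>
      intro A hA hGA hvA
      obtain ⟨K, hK, heq⟩ := hZW
      obtain ⟨rfl, rfl⟩ := Prod.mk.inj heq
      obtain ⟨hKF, hKq⟩ := Finset.mem_erase.1 hK
      by_contra hcon
      have hGK := aux_share hjt hA hKq hvA hw hGA hcon
      have hKG : K ≠ G := by
        rintro rfl
        exact hk (fun z hz => ⟨aux_varsQ hKq (aux_key_sub S K hz), hZ z hz⟩)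
      exact hcon (aux_plus_closed hKq hKG
        (fun z hz => ih z hz K hKq hGK (aux_key_sub S K hz)) hw)
  refine (aux_att_iff hjt).2 ⟨hF, hH, hne, ?_⟩
  have gen : ∀ B, ReflTransGen (auxR S q E G) G B → ReflTransGen (auxR S q E F) F B := by
    intro B hB
    induction hB with
    | refl => exact h1
    | @tail a b hGa hab ih =>
      refine ih.tail ⟨hab.1, ?_⟩
      intro hsub
      apply hab.2
      intro v hv
      have haq := (hjt.2.1 a b hab.1).1
      have hv' := hv
      simp only [Finset.coe_inter, Set.mem_inter_iff, Finset.mem_coe] at hv'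
      exact key v (hsub hv).2 a haq hGa hv'.1
  exact gen H h2

open Relation in
theorem aux_cycle_walk {att : Atom → Atom → Prop} {L : List Atom} (hL : IsCycle att L)
    (i : ℕ) (hi : i < L.length) :
    (∀ k, ReflTransGen att L[i] (L[(i + k) % L.length]'(Nat.mod_lt _ (by omega)))) := by
  intro k
  induction k with
  | zero => 
    have : (i + 0) % L.length = i := by simp [Nat.mod_eq_of_lt hi]
    simp only [this]
    exact ReflTransGen.refl
  | succ k ih =>
    refine ih.tail ?_
    have hj : (i + k) % L.length < L.length := Nat.mod_lt _ (by omega)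
    have := hL.2.2 (L[(i + k) % L.length], L[((i + k) % L.length + 1) % L.length]'(Nat.mod_lt _ (by omega))) (by
      unfold cyclePairs
      rw [List.mem_iff_getElem]
      refine ⟨(i + k) % L.length, by simp; exact hj, ?_⟩
      simp [List.getElem_rotate])
    simpa [Nat.add_assoc] using this

open Relation in
theorem aux_cycle_reach {att : Atom → Atom → Prop} {L : List Atom} (hL : IsCycle att L)
    {A B : Atom} (hA : A ∈ L) (hB : B ∈ L) : ReflTransGen att A B := by
  obtain ⟨i, hi, rfl⟩ := List.mem_iff_getElem.1 hA
  obtain ⟨j, hj, rfl⟩ := List.mem_iff_getElem.1 hB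
  have := aux_cycle_walk hL i hi (j + L.length - i)
  have h : (i + (j + L.length - i)) % L.length = j := by
    rw [show i + (j + L.length - i) = j + L.length by omega]
    simp [Nat.mod_eq_of_lt hj]
  simpa only [h] using this

open Relation in
theorem aux_partner {S : Schema} {q : Finset Atom} {E : Atom → Atom → Prop}
    (hjt : IsJoinTree q E) {L : List Atom} (hL : IsCycle (Attacks S q E) L) {F : Atom}
    (hF : F ∈ L) : ∃ G, Attacks S q E F G ∧ Attacks S q E G F := by
  have gen : ∀ a, ReflTransGen (Attacks S q E) a F → Attacks S q E F a →
      ∃ G, Attacks S q E F G ∧ Attacks S q E G F := by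
    intro a ha
    induction ha using ReflTransGen.head_induction_on with
    | refl => intro h; exact absurd rfl h.2.2.1
    | @head a c hac _ ih =>
      intro hFa
      by_cases hcF : F = c
      · subst hcF
        exact ⟨a, hFa, hac⟩
      · rcases aux_trans hjt hFa hac hcF with h | h
        · exact ih h
        · exact ⟨a, hFa, h⟩
  have hex : ∃ B ∈ L, B ≠ F := by
    by_contra hcon
    push Not at hcon
    have h0 := hcon (L[0]'(by have := hL.1; omega)) (List.getElem_mem _)
    have h1 := hcon (L[1]'(by have := hL.1; omega)) (List.getElem_mem _)
    have := (hL.2.1.getElem_inj_iff (i := 0) (j := 1)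
      (hi := by have := hL.1; omega) (hj := by have := hL.1; omega)).1 (h0.trans h1.symm)
    omega
  obtain ⟨B, hB, hBF⟩ := hex
  rcases ReflTransGen.cases_head (aux_cycle_reach hL hF hB) with h | ⟨c, hc, hcB⟩
  · exact absurd h.symm hBF
  · exact gen c (hcB.trans (aux_cycle_reach hL hB hF)) hc

open Relation in
/-- Suppose every cycle of the attack graph of a join tree for `q`
is terminal and every atom of `q` belongs to some cycle. Then (1) a variable
occurring in atoms of two distinct cycles belongs to `key(F)` for every atom
`F` of either cycle, and (2) for every weak attack `F ↝ G`, `key(G) ⊆ vars(F)`. -/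
theorem statement8 (S : Schema) (q : Finset Atom) (hq : ∀ F ∈ q, wfAtom S F)
    (E : Atom → Atom → Prop) (hjt : IsJoinTree q E)
    (hterm : ∀ L : List Atom, IsCycle (Attacks S q E) L →
      TerminalCycle (Attacks S q E) L)
    (hall : ∀ F ∈ q, ∃ L : List Atom, IsCycle (Attacks S q E) L ∧ F ∈ L) :
    (∀ (x : ℕ) (L₁ L₂ : List Atom),
      IsCycle (Attacks S q E) L₁ → IsCycle (Attacks S q E) L₂ →
      L₁.toFinset ≠ L₂.toFinset →
      (∃ F ∈ L₁, x ∈ varsA F) → (∃ G ∈ L₂, x ∈ varsA G) →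
      ∀ F : Atom, F ∈ L₁ ∨ F ∈ L₂ → x ∈ keyVars S F) ∧
    (∀ F G : Atom, Attacks S q E F G → Weak S q F G → keyVars S G ⊆ varsA F) := by
  -- every atom has a mutual partner, which is the only atom it attacks
  have huniq : ∀ F G, Attacks S q E F G → Attacks S q E G F →
      ∀ B, Attacks S q E F B → B = G := by
    intro F G h1 h2 B hB
    have hc : IsCycle (Attacks S q E) [F, G] := by
      refine ⟨by simp, by simpa using h1.2.2.1, ?_⟩
      intro e he
      simp [cyclePairs] at he
      rcases he with rfl | rfl
      · exact h1
      · exact h2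
    have := hterm _ hc F (by simp) B hB
    simp only [List.mem_cons, List.not_mem_nil, or_false] at this
    rcases this with rfl | h
    · exact absurd rfl hB.2.2.1
    · exact h
  have hmut : ∀ F G, Attacks S q E F G → Attacks S q E G F := by
    intro F G h
    obtain ⟨L, hL, hFL⟩ := hall F h.1
    obtain ⟨G', h1, h2⟩ := aux_partner hjt hL hFL
    rwa [huniq F G' h1 h2 G h]
  have huniq' : ∀ F G, Attacks S q E F G → ∀ B, Attacks S q E F B → B = G :=
    fun F G h => huniq F G h (hmut F G h)
  -- outer variables belong to the closure
  have houter : ∀ F G, Attacks S q E F G → ∀ A, A = F ∨ A = G → ∀ H ∈ q, H ≠ F → H ≠ G →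
      ∀ x, x ∈ varsA A → x ∈ varsA H → x ∈ plusCl S q F := by
    intro F G h A hA H hH hHF hHG x hxA hxH
    by_contra hcon
    have h' := (aux_att_iff hjt).1 h
    have hFA : A ∈ q ∧ ReflTransGen (auxR S q E F) F A := by
      rcases hA with rfl | rfl
      · exact ⟨h.1, ReflTransGen.refl⟩
      · exact ⟨h.2.1, h'.2.2.2⟩
    have hFH := aux_share hjt hFA.1 hH hxA hxH hFA.2 hcon
    exact hHG (huniq' F G h H ((aux_att_iff hjt).2 ⟨h.1, hH, hHF.symm, hFH⟩))
  -- no key of another atom is contained in the variables of an atom of the pair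
  have hnokey : ∀ F G, Attacks S q E F G → ∀ H ∈ q, H ≠ F → H ≠ G →
      ¬ ∀ z ∈ keyVars S H, z ∈ varsA F := by
    intro F G h H hH hHF hHG hsub
    obtain ⟨L, hL, hHL⟩ := hall H hH
    obtain ⟨H', h1, h2⟩ := aux_partner hjt hL hHL
    have hFH' : F ≠ H' := by
      rintro rfl
      exact hHG (huniq' F G h H h2)
    refine aux_att_key hjt h2 (fun z hz => ?_)
    exact houter H' H h2 H (Or.inr rfl) F h.1 hFH' (Ne.symm hHF) z (aux_key_sub S H hz)
      (hsub z hz)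
  -- hence F^+ is just the key
  have hplus : ∀ F G, Attacks S q E F G → ∀ x ∈ plusCl S q F, x ∈ keyVars S F := by
    rintro F G h x ⟨-, hx⟩
    induction hx with
    | base hv => exact hv
    | @step Z W w hZW hZ hw ih =>
      obtain ⟨K, hK, heq⟩ := hZW
      obtain ⟨rfl, rfl⟩ := Prod.mk.inj heq
      obtain ⟨hKF, hKq⟩ := Finset.mem_erase.1 hK
      exfalso
      by_cases hKG : K = G
      · subst hKG
        exact aux_att_key hjt h
          (fun z hz => ⟨aux_varsQ hKq (aux_key_sub S K hz), hZ z hz⟩)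
      · exact hnokey F G h K hKq hKF hKG (fun z hz => aux_key_sub S F (ih z hz))
  constructor
  · -- part (1)
    have hmem : ∀ L, IsCycle (Attacks S q E) L → ∀ F ∈ L, ∃ G, Attacks S q E F G ∧
        ∀ B, B ∈ L ↔ B = F ∨ B = G := by
      intro L hL F hF
      obtain ⟨G, h1, h2⟩ := aux_partner hjt hL hF
      refine ⟨G, h1, fun B => ⟨fun hB => ?_, ?_⟩⟩
      · have hr := aux_cycle_reach hL hF hB
        induction hr with
        | refl => exact Or.inl rfl
        | @tail b c _ hbc ih =>
          have hb := aux_cycle_reach hL hF hF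
          rcases ih (by
            rename_i hFb
            clear hb
            have : ∀ d, ReflTransGen (Attacks S q E) F d → d ∈ L := by
              intro d hd
              induction hd with
              | refl => exact hF
              | tail _ h ih' => exact hterm L hL _ ih' _ h
            exact this b hFb) with rfl | rfl
          · exact Or.inr (huniq' _ _ h1 _ hbc)
          · exact Or.inl (huniq' _ _ h2 _ hbc)
      · rintro (rfl | rfl)
        · exact hF
        · exact hterm L hL F hF _ h1
    have half : ∀ (x : ℕ) (L₁ L₂ : List Atom),
        IsCycle (Attacks S q E) L₁ → IsCycle (Attacks S q E) L₂ →
        L₁.toFinset ≠ L₂.toFinset →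
        (∃ F ∈ L₁, x ∈ varsA F) → (∃ G ∈ L₂, x ∈ varsA G) →
        ∀ F ∈ L₁, x ∈ keyVars S F := by
      rintro x L₁ L₂ hL₁ hL₂ hne ⟨A, hA, hxA⟩ ⟨H, hH, hxH⟩ F hF
      obtain ⟨G, hFG, hiff⟩ := hmem L₁ hL₁ F hF
      obtain ⟨H', hHH', hiff'⟩ := hmem L₂ hL₂ H hH
      have hHL : H ∉ L₁ := by
        intro hHL
        obtain ⟨H'', hHH'', hiff''⟩ := hmem L₁ hL₁ H hHL
        have := huniq' _ _ hHH' _ hHH''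
        subst this
        apply hne
        ext B
        rw [List.mem_toFinset, List.mem_toFinset, hiff', hiff'']
      have hHn : ¬ (H = F ∨ H = G) := fun h => hHL ((hiff H).2 h)
      push Not at hHn
      exact hplus F G hFG x
        (houter F G hFG A ((hiff A).1 hA) H hHH'.1 hHn.1 hHn.2 x hxA hxH)
    intro x L₁ L₂ hL₁ hL₂ hne hx₁ hx₂ F hF
    rcases hF with hF | hF
    · exact half x L₁ L₂ hL₁ hL₂ hne hx₁ hx₂ F hF
    · exact half x L₂ L₁ hL₂ hL₁ (Ne.symm hne) hx₂ hx₁ F hF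
  · -- part (2)
    intro F G h hw
    by_contra hcon
    have hcl : ∀ y, InCl (FDq S q) (keyVars S F) y → y ∈ varsA F := by
      intro y hy
      induction hy with
      | base hv => exact aux_key_sub S F hv
      | @step Z W w hZW hZ hwW ih =>
        obtain ⟨K, hKq, heq⟩ := hZW
        obtain ⟨rfl, rfl⟩ := Prod.mk.inj heq
        by_cases hKF : K = F
        · subst hKF
          exact hwW
        · exfalso
          by_cases hKG : K = G
          · subst hKG
            exact hcon (fun z hz => ih z hz)
          · exact hnokey F G h K hKq hKF hKG ih
    exact hcon (fun y hy => hcl y (hw (Finset.mem_coe.2 hy)).2)
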